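/- Let R be a commutative domain and B an R-algebra. Then Tdeg(B) ≤ GKdim(B). Moreover, if B is commutative, then Tdeg(B) = GKdim(B). -/

import Mathlib

open TensorProduct Filter
open scoped ENNReal

/-- The rank of an `R`-module `M` over a commutative domain `R`:
the dimension over the field of fractions `Q = Frac(R)` of `Q ⊗[R] M`
(as a natural number; all modules to which this is applied are finitely generated,
so their rank is finite). -/
noncomputable def modRank (R : Type*) [CommRing R] [IsDomain R]
    (M : Type*) [AddCommGroup M] [Module R M] : ℕ :=
  Module.finrank (FractionRing R) (FractionRing R ⊗[R] M)

/-- A frame of an `R`-algebra `B` is a finitely generated `R`-submodule of `B`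
containing `1`. -/
def IsFrame (R : Type*) [CommRing R] {B : Type*} [Ring B] [Algebra R B]
    (V : Submodule R B) : Prop :=
  V.FG ∧ (1 : B) ∈ V

/-- The Gelfand-Kirillov dimension of an `R`-algebra `B` over a commutative domain `R`:
`GKdim(B) = sup_V limsup_{n → ∞} log_n (rank V^n)`, where `V` ranges over all
frames of `B`. -/
noncomputable def GKdim (R : Type*) [CommRing R] [IsDomain R]
    (B : Type*) [Ring B] [Algebra R B] : ℝ≥0∞ :=
  ⨆ (V : Submodule R B) (_ : IsFrame R V),
    Filter.limsup
      (fun n : ℕ => ENNReal.ofReal (Real.logb n (modRank R ↥(V ^ n)))) Filter.atTop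

/-- The Gelfand-Kirillov transcendence degree of an `R`-algebra `B` over a commutative
domain `R`: `Tdeg(B) = sup_V inf_b GKdim(R[bV])`, where `V` ranges over all frames of
`B`, `b` over all regular elements of `B`, and `R[bV]` is the `R`-subalgebra of `B`
generated by the set `bV = {b·v : v ∈ V}`. -/
noncomputable def GKTdeg (R : Type*) [CommRing R] [IsDomain R]
    (B : Type*) [Ring B] [Algebra R B] : ℝ≥0∞ :=
  ⨆ (V : Submodule R B) (_ : IsFrame R V),
    ⨅ (b : B) (_ : IsRegular b),
      GKdim R ↥(Algebra.adjoin R {y : B | ∃ v ∈ V, y = b * v})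

/-- The rank is monotone along injections into finitely generated modules. -/
lemma modRank_le_of_injective {R M N : Type*} [CommRing R] [IsDomain R]
    [AddCommGroup M] [Module R M] [AddCommGroup N] [Module R N] [Module.Finite R N]
    (f : M →ₗ[R] N) (hf : Function.Injective f) : modRank R M ≤ modRank R N := by
  have : Module.Flat R (FractionRing R) := IsLocalization.flat _ (nonZeroDivisors R)
  refine LinearMap.finrank_le_finrank_of_injective (f := f.baseChange (FractionRing R)) ?_
  exact Module.Flat.lTensor_preserves_injective_linearMap (M := FractionRing R) f hf

lemma ofReal_logb_natCast_mono (n : ℕ) {a b : ℕ} (h : a ≤ b) :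
    ENNReal.ofReal (Real.logb n a) ≤ ENNReal.ofReal (Real.logb n b) := by
  refine ENNReal.ofReal_le_ofReal ?_
  refine div_le_div_of_nonneg_right ?_ (Real.log_natCast_nonneg n)
  rcases Nat.eq_zero_or_pos a with rfl | ha
  · simpa using Real.log_natCast_nonneg b
  · exact Real.log_le_log (by exact_mod_cast ha) (by exact_mod_cast h)

/-- The growth of a frame `V` is at most the GK dimension of any algebra `A` having a frame `U`
whose powers receive injections from the powers of `V`. -/
lemma limsup_logb_modRank_le_GKdim {R A B : Type*} [CommRing R] [IsDomain R]
    [Ring A] [Algebra R A] [Ring B] [Algebra R B] {V : Submodule R B} {U : Submodule R A}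
    (hU : IsFrame R U) (f : ∀ n : ℕ, ↥(V ^ n) →ₗ[R] ↥(U ^ n))
    (hf : ∀ n, Function.Injective (f n)) :
    limsup (fun n : ℕ => ENNReal.ofReal (Real.logb n (modRank R ↥(V ^ n)))) atTop ≤
      GKdim R A := by
  refine le_trans (limsup_le_limsup (Eventually.of_forall fun n => ?_))
    (le_iSup₂ (f := fun (V : Submodule R A) (_ : IsFrame R V) =>
      limsup (fun n : ℕ => ENNReal.ofReal (Real.logb n (modRank R ↥(V ^ n)))) atTop) U hU)
  have : Module.Finite R ↥(U ^ n) := Module.Finite.iff_fg.2 (hU.1.pow n)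
  exact ofReal_logb_natCast_mono n (modRank_le_of_injective (f n) (hf n))

lemma GKdim_le_of_injective {R A B : Type*} [CommRing R] [IsDomain R]
    [Ring A] [Algebra R A] [Ring B] [Algebra R B] (g : A →ₐ[R] B)
    (hg : Function.Injective g) : GKdim R A ≤ GKdim R B := by
  refine iSup₂_le fun V hV => ?_
  refine limsup_logb_modRank_le_GKdim (U := V.map g.toLinearMap)
    ⟨hV.1.map _, 1, hV.2, map_one g⟩
    (fun n => g.toLinearMap.restrict fun x hx => ?_) fun n x y h => ?_
  · rw [← Submodule.map_pow]
    exact Submodule.mem_map_of_mem hx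
  · exact Subtype.ext (hg (congrArg Subtype.val h))

/-- If `b` is central, then `b ^ n * V ^ n ≤ (b * V) ^ n`. -/
lemma pow_mul_mem_pow_of_mem_pow {R B : Type*} [CommRing R] [Ring B] [Algebra R B]
    {b : B} (hb : ∀ a, b * a = a * b) {V W : Submodule R B} (h : ∀ v ∈ V, b * v ∈ W)
    (n : ℕ) : ∀ x ∈ V ^ n, b ^ n * x ∈ W ^ n := by
  induction n with
  | zero => simp
  | succ n ih =>
    suffices V ^ (n + 1) ≤ (W ^ (n + 1)).comap (LinearMap.mulLeft R (b ^ (n + 1))) from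
      fun x hx => this hx
    rw [pow_succ, Submodule.mul_le]
    intro x hx v hv
    have e : b ^ (n + 1) * (x * v) = (b ^ n * x) * (b * v) := by
      rw [pow_succ, mul_assoc, ← mul_assoc b, hb x]
      simp only [mul_assoc]
    rw [Submodule.mem_comap, LinearMap.mulLeft_apply, e, pow_succ]
    exact Submodule.mul_mem_mul (ih x hx) (h v hv)

/-- For a central regular element `b`, the growth of a frame `V` is at most `GKdim (R[bV])`. -/
lemma limsup_logb_modRank_le_GKdim_adjoin {R B : Type*} [CommRing R] [IsDomain R]
    [Ring B] [Algebra R B] {V : Submodule R B} (hV : IsFrame R V) {b : B}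
    (hb : ∀ a, b * a = a * b) (hreg : IsRegular b) :
    limsup (fun n : ℕ => ENNReal.ofReal (Real.logb n (modRank R ↥(V ^ n)))) atTop ≤
      GKdim R ↥(Algebra.adjoin R {y : B | ∃ v ∈ V, y = b * v}) := by
  set A := Algebra.adjoin R {y : B | ∃ v ∈ V, y = b * v}
  have hA : ∀ v ∈ V, b * v ∈ A := fun v hv => Algebra.subset_adjoin ⟨v, hv, rfl⟩
  have : Module.Finite R V := Module.Finite.iff_fg.2 hV.1
  let g : V →ₗ[R] A := LinearMap.codRestrict (Subalgebra.toSubmodule A)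
    (LinearMap.mulLeft R b ∘ₗ V.subtype) fun v => hA v v.2
  let U : Submodule R A := 1 ⊔ LinearMap.range g
  have hU : IsFrame R U := by
    refine ⟨Submodule.FG.sup ?_ (Module.Finite.iff_fg.1 inferInstance),
      Submodule.mem_sup_left (Submodule.one_le.1 le_rfl)⟩
    rw [Submodule.one_eq_span]
    exact Submodule.fg_span_singleton _
  have key (n : ℕ) (x : B) (hx : x ∈ V ^ n) : ∃ u ∈ U ^ n, A.val u = b ^ n * x := by
    have h := pow_mul_mem_pow_of_mem_pow (W := U.map A.val.toLinearMap) hb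
      (fun v hv => ⟨g ⟨v, hv⟩, Submodule.mem_sup_right ⟨_, rfl⟩, rfl⟩) n x hx
    rwa [← Submodule.map_pow] at h
  have hmem (n : ℕ) (x : B) (hx : x ∈ V ^ n) : b ^ n * x ∈ A := by
    obtain ⟨u, -, hu⟩ := key n x hx
    exact hu ▸ u.2
  refine limsup_logb_modRank_le_GKdim hU
    (fun n => LinearMap.codRestrict (U ^ n) (LinearMap.codRestrict (Subalgebra.toSubmodule A)
      (LinearMap.mulLeft R (b ^ n) ∘ₗ (V ^ n).subtype) fun x => hmem n x x.2) fun x => ?_)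
    fun n x y h => ?_
  · obtain ⟨u, hu, e⟩ := key n x x.2
    convert hu
    exact Subtype.ext e.symm
  · have h' : b ^ n * (x : B) = b ^ n * y := congrArg (fun z : ↥(U ^ n) => ((z : A) : B)) h
    exact Subtype.ext ((hreg.left.pow n) h')

/-- For an `R`-algebra `B` over a commutative domain `R`,
`Tdeg(B) ≤ GKdim(B)`; moreover, if `B` is commutative, then `Tdeg(B) = GKdim(B)`. -/
theorem GKTdeg_le_GKdim_and_eq_of_comm (R : Type*) [CommRing R] [IsDomain R]
    (B : Type*) [Ring B] [Algebra R B] :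
    GKTdeg R B ≤ GKdim R B ∧
      ((∀ a b : B, a * b = b * a) → GKTdeg R B = GKdim R B) := by
  have hle : GKTdeg R B ≤ GKdim R B := iSup₂_le fun V _ =>
    (iInf₂_le 1 isRegular_one).trans (GKdim_le_of_injective (Subalgebra.val _) Subtype.val_injective)
  refine ⟨hle, fun hcomm => hle.antisymm (iSup₂_mono fun V hV => le_iInf₂ fun b hb => ?_)⟩
  exact limsup_logb_modRank_le_GKdim_adjoin hV (hcomm b) hb
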